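/- Let c₁, c₂, c₃ be real numbers such that ρ(c₁,c₂,c₃) is positive semidefinite, set c := max(|c₁|, |c₂|), assume 0 < c and |c₃| ≤ c, and let q₁ := 2 / (2 + c + √(c² + 4(c − c₃))). If 4(c₁² + c₂²) > (c₁² + c₂² + c₃² − c²) · (2 + c + √(c² + 4(c − c₃)))², then the symmetric local amplitude damping channel with parameter p_opt := 1 − q₁ strictly enhances the RSP-fidelity: F_RSP(Φ_{p_opt}(ρ(c₁,c₂,c₃))) > F_RSP(ρ(c₁,c₂,c₃)). -/

import Mathlib

open Matrix Kronecker ComplexOrder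

noncomputable section

def pauli : Fin 3 → Matrix (Fin 2) (Fin 2) ℂ :=
  ![!![0, 1; 1, 0], !![0, -Complex.I; Complex.I, 0], !![1, 0; 0, -1]]

def corr (ρ : Matrix (Fin 2 × Fin 2) (Fin 2 × Fin 2) ℂ) : Matrix (Fin 3) (Fin 3) ℝ :=
  Matrix.of fun k l => (Matrix.trace (ρ * (pauli k ⊗ₖ pauli l))).re

def lambdaMax (M : Matrix (Fin 3) (Fin 3) ℝ) : ℝ :=
  sSup {x : ℝ | ∃ v : Fin 3 → ℝ, v ≠ 0 ∧ M.mulVec v = x • v}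

def Frsp (ρ : Matrix (Fin 2 × Fin 2) (Fin 2 × Fin 2) ℂ) : ℝ :=
  (1 / 2) * (Matrix.trace ((corr ρ)ᵀ * corr ρ) - lambdaMax ((corr ρ)ᵀ * corr ρ))

def damp (p : ℝ) : Fin 2 → Matrix (Fin 2) (Fin 2) ℂ :=
  ![!![1, 0; 0, (Real.sqrt (1 - p) : ℂ)], !![0, (Real.sqrt p : ℂ); 0, 0]]

def Phi (p : ℝ) (ρ : Matrix (Fin 2 × Fin 2) (Fin 2 × Fin 2) ℂ) :
    Matrix (Fin 2 × Fin 2) (Fin 2 × Fin 2) ℂ :=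
  ∑ i : Fin 2, ∑ j : Fin 2, (damp p i ⊗ₖ damp p j) * ρ * (damp p i ⊗ₖ damp p j)ᴴ

def bellDiag (c₁ c₂ c₃ : ℝ) : Matrix (Fin 2 × Fin 2) (Fin 2 × Fin 2) ℂ :=
  (1 / 4 : ℂ) • (1 + (c₁ : ℂ) • (pauli 0 ⊗ₖ pauli 0) + (c₂ : ℂ) • (pauli 1 ⊗ₖ pauli 1)
    + (c₃ : ℂ) • (pauli 2 ⊗ₖ pauli 2))

def bloch (ρ : Matrix (Fin 2 × Fin 2) (Fin 2 × Fin 2) ℂ) : Fin 3 → ℝ :=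
  fun k => (Matrix.trace (ρ * (pauli k ⊗ₖ (1 : Matrix (Fin 2) (Fin 2) ℂ)))).re

def Dg (ρ : Matrix (Fin 2 × Fin 2) (Fin 2 × Fin 2) ℂ) : ℝ :=
  (1 / 2) * ((∑ k, bloch ρ k ^ 2) + Matrix.trace (corr ρ * (corr ρ)ᵀ)
    - lambdaMax (Matrix.vecMulVec (bloch ρ) (bloch ρ) + corr ρ * (corr ρ)ᵀ))


/-- The single-qubit amplitude damping channel. -/
def amplitudeDamping (p : ℝ) (A : Matrix (Fin 2) (Fin 2) ℂ) : Matrix (Fin 2) (Fin 2) ℂ :=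
  ∑ i : Fin 2, damp p i * A * (damp p i)ᴴ

theorem Phi_kronecker (p : ℝ) (A B : Matrix (Fin 2) (Fin 2) ℂ) :
    Phi p (A ⊗ₖ B) = amplitudeDamping p A ⊗ₖ amplitudeDamping p B := by
  simp only [Phi, amplitudeDamping, Fin.sum_univ_two, conjTranspose_kronecker,
    ← mul_kronecker_mul, add_kronecker, kronecker_add]
  abel

theorem Phi_add (p : ℝ) (ρ τ : Matrix (Fin 2 × Fin 2) (Fin 2 × Fin 2) ℂ) :
    Phi p (ρ + τ) = Phi p ρ + Phi p τ := by
  simp only [Phi, mul_add, add_mul, Finset.sum_add_distrib]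

theorem Phi_smul (p : ℝ) (a : ℂ) (ρ : Matrix (Fin 2 × Fin 2) (Fin 2 × Fin 2) ℂ) :
    Phi p (a • ρ) = a • Phi p ρ := by
  simp only [Phi, Matrix.mul_smul, Matrix.smul_mul, Finset.smul_sum]

theorem ofReal_sqrt_mul_self {x : ℝ} (hx : 0 ≤ x) :
    (Real.sqrt x : ℂ) * (Real.sqrt x : ℂ) = x := by
  rw [← Complex.ofReal_mul, Real.mul_self_sqrt hx]

theorem amplitudeDamping_one {p : ℝ} (hp₀ : 0 ≤ p) (hp₁ : p ≤ 1) :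
    amplitudeDamping p 1 = 1 + (p : ℂ) • pauli 2 := by
  have h₀ := ofReal_sqrt_mul_self hp₀
  have h₁ := ofReal_sqrt_mul_self (sub_nonneg.2 hp₁)
  ext i j
  fin_cases i <;> fin_cases j <;>
    simp [amplitudeDamping, damp, pauli, vecMul, dotProduct, Fin.sum_univ_two, h₀, h₁]
  ring

theorem amplitudeDamping_pauli_zero (p : ℝ) :
    amplitudeDamping p (pauli 0) = (Real.sqrt (1 - p) : ℂ) • pauli 0 := by
  ext i j
  fin_cases i <;> fin_cases j <;>
    simp [amplitudeDamping, damp, pauli, vecMul, dotProduct, Fin.sum_univ_two]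

theorem amplitudeDamping_pauli_one (p : ℝ) :
    amplitudeDamping p (pauli 1) = (Real.sqrt (1 - p) : ℂ) • pauli 1 := by
  ext i j
  fin_cases i <;> fin_cases j <;>
    simp [amplitudeDamping, damp, pauli, vecMul, dotProduct, Fin.sum_univ_two, mul_comm]

theorem amplitudeDamping_pauli_two {p : ℝ} (hp₀ : 0 ≤ p) (hp₁ : p ≤ 1) :
    amplitudeDamping p (pauli 2) = ((1 - p : ℝ) : ℂ) • pauli 2 := by
  have h₀ := ofReal_sqrt_mul_self hp₀
  have h₁ := ofReal_sqrt_mul_self (sub_nonneg.2 hp₁)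
  ext i j
  fin_cases i <;> fin_cases j <;>
    simp [amplitudeDamping, damp, pauli, vecMul, dotProduct, Fin.sum_univ_two, h₀, h₁]
  ring

theorem trace_pauli (k : Fin 3) : trace (pauli k) = 0 := by
  fin_cases k <;> simp [pauli, trace_fin_two]

theorem trace_pauli_mul_pauli (k l : Fin 3) :
    trace (pauli k * pauli l) = if k = l then 2 else 0 := by
  fin_cases k <;> fin_cases l <;> simp [pauli, trace_fin_two] <;> norm_num

theorem corr_bellDiag (c₁ c₂ c₃ : ℝ) :
    corr (bellDiag c₁ c₂ c₃) = diagonal ![c₁, c₂, c₃] := by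
  ext k l
  simp only [corr, bellDiag, of_apply, ← one_kronecker_one (α := ℂ), add_mul, smul_mul,
    ← mul_kronecker_mul, trace_add, trace_smul, trace_kronecker, trace_pauli_mul_pauli, one_mul,
    trace_pauli]
  fin_cases k <;> fin_cases l <;> simp <;> ring

/-- Symmetric local amplitude damping keeps the correlation matrix of a Bell-diagonal state
diagonal. -/
theorem corr_Phi_bellDiag {p : ℝ} (hp₀ : 0 ≤ p) (hp₁ : p ≤ 1) (c₁ c₂ c₃ : ℝ) :
    corr (Phi p (bellDiag c₁ c₂ c₃)) =
      diagonal ![(1 - p) * c₁, (1 - p) * c₂, (1 - p) ^ 2 * c₃ + p ^ 2] := by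
  have h := ofReal_sqrt_mul_self (sub_nonneg.2 hp₁)
  ext k l
  simp only [corr, bellDiag, of_apply, ← one_kronecker_one (α := ℂ), Phi_add, Phi_smul,
    Phi_kronecker, amplitudeDamping_one hp₀ hp₁, amplitudeDamping_pauli_zero,
    amplitudeDamping_pauli_one, amplitudeDamping_pauli_two hp₀ hp₁, smul_kronecker,
    kronecker_smul, add_kronecker, kronecker_add, smul_smul, h, add_mul, smul_mul,
    ← mul_kronecker_mul, trace_add, trace_smul, trace_kronecker, trace_pauli_mul_pauli, one_mul,
    trace_pauli]
  simp only [smul_eq_mul, ← Complex.ofReal_mul]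
  fin_cases k <;> fin_cases l <;> simp <;> ring

theorem lambdaMax_diagonal {d : Fin 3 → ℝ} {m : ℝ} (hle : ∀ i, d i ≤ m) (hm : ∃ i, d i = m) :
    lambdaMax (diagonal d) = m := by
  refine IsGreatest.csSup_eq ⟨?_, ?_⟩
  · obtain ⟨i, rfl⟩ := hm
    refine ⟨Pi.single i 1, by simp, ?_⟩
    ext j
    by_cases h : j = i
    · subst h; simp [mulVec_diagonal]
    · simp [mulVec_diagonal, h]
  · rintro x ⟨v, hv, h⟩
    obtain ⟨i, hi⟩ := Function.ne_iff.1 hv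
    have h_eq := congrFun h i
    rw [mulVec_diagonal, Pi.smul_apply, smul_eq_mul] at h_eq
    exact (mul_right_cancel₀ hi h_eq) ▸ hle i

theorem Frsp_of_corr_eq_diagonal {ρ : Matrix (Fin 2 × Fin 2) (Fin 2 × Fin 2) ℂ}
    {d : Fin 3 → ℝ} (hρ : corr ρ = diagonal d) {m : ℝ} (hle : ∀ i, d i ^ 2 ≤ m)
    (hm : ∃ i, d i ^ 2 = m) :
    Frsp ρ = (1 / 2) * (∑ i, d i ^ 2 - m) := by
  rw [Frsp, hρ, diagonal_transpose, diagonal_mul_diagonal, trace_diagonal]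
  simp only [← pow_two]
  rw [lambdaMax_diagonal hle hm]

/-- Under the enhancibility criterion, the symmetric local amplitude damping channel
with the optimal parameter strictly increases the RSP-fidelity of a Bell-diagonal
state. -/
theorem frsp_enhanced_by_optimal_damping
    (c₁ c₂ c₃ : ℝ) (hpsd : (bellDiag c₁ c₂ c₃).PosSemidef)
    (c : ℝ) (hc : c = max |c₁| |c₂|) (hcpos : 0 < c) (hc₃ : |c₃| ≤ c)
    (q₁ : ℝ) (hq₁ : q₁ = 2 / (2 + c + Real.sqrt (c ^ 2 + 4 * (c - c₃))))
    (hcrit : 4 * (c₁ ^ 2 + c₂ ^ 2) >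
      (c₁ ^ 2 + c₂ ^ 2 + c₃ ^ 2 - c ^ 2)
        * (2 + c + Real.sqrt (c ^ 2 + 4 * (c - c₃))) ^ 2) :
    Frsp (Phi (1 - q₁) (bellDiag c₁ c₂ c₃)) > Frsp (bellDiag c₁ c₂ c₃) := by
  set s := Real.sqrt (c ^ 2 + 4 * (c - c₃)) with hs
  have hc₃_le : c₃ ≤ c := (le_abs_self c₃).trans hc₃
  have hs_nonneg : 0 ≤ s := Real.sqrt_nonneg _
  have hs_sq : s ^ 2 = c ^ 2 + 4 * (c - c₃) :=
    Real.sq_sqrt (by nlinarith [sq_nonneg c])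
  have hS : 0 < 2 + c + s := by positivity
  have hq_nonneg : 0 ≤ q₁ := by rw [hq₁]; positivity
  have hq_le : q₁ ≤ 1 := by rw [hq₁, div_le_one hS]; linarith
  have hroot : q₁ ^ 2 * c₃ + (1 - q₁) ^ 2 = q₁ * c := by
    rw [hq₁]
    field_simp
    linear_combination hs_sq
  have h₁ : c₁ ^ 2 ≤ c ^ 2 := sq_le_sq' (by
      linarith [neg_abs_le c₁, le_max_left |c₁| |c₂|])
    ((le_abs_self c₁).trans (hc ▸ le_max_left _ _))
  have h₂ : c₂ ^ 2 ≤ c ^ 2 := sq_le_sq' (by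
      linarith [neg_abs_le c₂, le_max_right |c₁| |c₂|])
    ((le_abs_self c₂).trans (hc ▸ le_max_right _ _))
  have h₃ : c₃ ^ 2 ≤ c ^ 2 := sq_le_sq' (abs_le.1 hc₃).1 hc₃_le
  have hmax : c₁ ^ 2 = c ^ 2 ∨ c₂ ^ 2 = c ^ 2 := by
    rcases max_choice |c₁| |c₂| with h | h
    · exact .inl (by rw [hc, h, sq_abs])
    · exact .inr (by rw [hc, h, sq_abs])
  have hbefore := Frsp_of_corr_eq_diagonal (corr_bellDiag c₁ c₂ c₃) (m := c ^ 2)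
    (by intro i; fin_cases i <;> simpa)
    (hmax.elim (fun h => ⟨0, h⟩) (fun h => ⟨1, h⟩))
  have hcorr := corr_Phi_bellDiag (sub_nonneg.2 hq_le) (sub_le_self 1 hq_nonneg) c₁ c₂ c₃
  rw [sub_sub_cancel, hroot] at hcorr
  have hafter := Frsp_of_corr_eq_diagonal hcorr (m := (q₁ * c) ^ 2)
    (by
      intro i
      fin_cases i
      · simpa [mul_pow] using mul_le_mul_of_nonneg_left h₁ (sq_nonneg q₁)
      · simpa [mul_pow] using mul_le_mul_of_nonneg_left h₂ (sq_nonneg q₁)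
      · simp)
    ⟨2, rfl⟩
  have hgain : c₁ ^ 2 + c₂ ^ 2 + c₃ ^ 2 - c ^ 2 < q₁ ^ 2 * (c₁ ^ 2 + c₂ ^ 2) := by
    have h_sq : q₁ ^ 2 * (c₁ ^ 2 + c₂ ^ 2) = 4 * (c₁ ^ 2 + c₂ ^ 2) / (2 + c + s) ^ 2 := by
      rw [hq₁, div_pow]
      ring
    rwa [h_sq, lt_div_iff₀ (by positivity)]
  rw [hbefore, hafter]
  simp [Fin.sum_univ_three]
  linarith

end
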